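/- Let w ∈ S_N avoid the patterns 45231, 45132, 43512, 34512, and 35412. If some N-occurrence {a, N, b, c} of the pattern 3412 in w (with a, b, c the letters playing the roles of 3, 1, 2 respectively) is such that there exists no k ∈ newrep(w) with (a,b,c) = (M_k, w̄(k), m_k), then w has an N-occurrence of at least one of the patterns 45123 and 45213. -/

import Mathlib

/-!
Common framework.  Permutations of `{1, …, m}` are modelled as `Equiv.Perm (Fin m)`
with 0-based positions and values.  The simple reflection `sr m i` (for
`0 ≤ i ≤ m - 2`, corresponding to the paper's `s_{i+1}`) swaps the values `i` and
`i + 1`.  Cut statistics `Mstat w k` / `mstat w k` (the paper's `M_{k+1}`/`m_{k+1}`)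
are respectively the maximum of the first `k + 1` entries and the minimum of the
remaining entries of the one-line notation of `w`.
-/

/-- The simple reflection swapping `i` and `i + 1` (0-based) in the symmetric group
on `Fin m`; the identity if out of range. -/
def sr (m i : ℕ) : Equiv.Perm (Fin m) :=
  if h : i + 1 < m then Equiv.swap ⟨i, Nat.lt_of_succ_lt h⟩ ⟨i + 1, h⟩ else 1

/-- `l` is a word in the simple reflections whose product is `w`. -/
def IsWord (m : ℕ) (l : List ℕ) (w : Equiv.Perm (Fin m)) : Prop :=
  (∀ i ∈ l, i + 1 < m) ∧ (l.map (sr m)).prod = w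

/-- The Coxeter length `ℓ(w)`: the minimal length of a word expressing `w`. -/
noncomputable def len {m : ℕ} (w : Equiv.Perm (Fin m)) : ℕ :=
  sInf {c | ∃ l : List ℕ, IsWord m l w ∧ l.length = c}

/-- `l` is a reduced decomposition of `w`. -/
def IsReducedWord {m : ℕ} (w : Equiv.Perm (Fin m)) (l : List ℕ) : Prop :=
  IsWord m l w ∧ l.length = len w

/-- The support of `w`: the letters appearing in some reduced decomposition. -/
noncomputable def supp {m : ℕ} (w : Equiv.Perm (Fin m)) : Set ℕ :=
  {i | ∃ l : List ℕ, IsReducedWord w l ∧ i ∈ l}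

/-- `rep w = ℓ(w) - |supp w|`, the number of repeated letters. -/
noncomputable def rep {m : ℕ} (w : Equiv.Perm (Fin m)) : ℕ :=
  len w - (supp w).ncard

/-- The value of `w` at the (0-based) position `i`, as a natural number. -/
def valAt {m : ℕ} (w : Equiv.Perm (Fin m)) (i : ℕ) : ℕ :=
  if h : i < m then (w ⟨i, h⟩ : ℕ) else 0

/-- The (0-based) position at which the value `v` occurs in `w`. -/
def posOf {m : ℕ} (w : Equiv.Perm (Fin m)) (v : ℕ) : ℕ :=
  if h : v < m then (w⁻¹ ⟨v, h⟩ : ℕ) else 0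

/-- `Mstat w k`: the maximum of the first `k + 1` entries of `w`. -/
noncomputable def Mstat {m : ℕ} (w : Equiv.Perm (Fin m)) (k : ℕ) : ℕ :=
  sSup {v | ∃ i : Fin m, (i : ℕ) ≤ k ∧ (w i : ℕ) = v}

/-- `mstat w k`: the minimum of the entries of `w` in positions `> k`. -/
noncomputable def mstat {m : ℕ} (w : Equiv.Perm (Fin m)) (k : ℕ) : ℕ :=
  sInf {v | ∃ i : Fin m, k < (i : ℕ) ∧ (w i : ℕ) = v}

/-- `wbar` is obtained from `w` by deleting the largest letter from the one-line
notation of `w` and sliding all subsequent letters one space to the left. -/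
def IsDeletion {n : ℕ} (w : Equiv.Perm (Fin (n + 1))) (wbar : Equiv.Perm (Fin n)) : Prop :=
  ∀ i : Fin n, (wbar i : ℕ) =
    if (i : ℕ) < posOf w n then valAt w (i : ℕ) else valAt w ((i : ℕ) + 1)

/-- `newrep w wbar`: the letters `k` with `s_k ∈ supp(wbar)` and `w⁻¹(top) ≤ k`. -/
noncomputable def newrep {n : ℕ} (w : Equiv.Perm (Fin (n + 1))) (wbar : Equiv.Perm (Fin n)) :
    Set ℕ :=
  {k | k ∈ supp wbar ∧ posOf w n ≤ k}

/-- An occurrence of the pattern `p` in `w`, recorded by its set `S` of values: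
there are positions `f 0 < f 1 < ⋯` whose values are in the same relative order
as `p`, and `S` is the corresponding set of values. -/
def IsOccSet {m c : ℕ} (p : Fin c → ℕ) (w : Equiv.Perm (Fin m)) (S : Finset ℕ) : Prop :=
  ∃ f : Fin c → Fin m, StrictMono f ∧ (∀ a b : Fin c, p a < p b ↔ w (f a) < w (f b)) ∧
    S = Finset.image (fun a => (w (f a) : ℕ)) Finset.univ

/-- An `N`-occurrence (here `N = n`, the largest 0-based value): an occurrence
whose largest letter is the largest value of `w`. -/
def IsTopOccSet {n c : ℕ} (p : Fin c → ℕ) (w : Equiv.Perm (Fin (n + 1))) (S : Finset ℕ) : Prop :=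
  IsOccSet p w S ∧ n ∈ S

/-- The number of occurrences of the pattern `p` in `w`. -/
noncomputable def occCount {m c : ℕ} (p : Fin c → ℕ) (w : Equiv.Perm (Fin m)) : ℕ :=
  Set.ncard {S : Finset ℕ | IsOccSet p w S}

/-- The number of `N`-occurrences of the pattern `p` in `w`. -/
noncomputable def topOccCount {n c : ℕ} (p : Fin c → ℕ) (w : Equiv.Perm (Fin (n + 1))) : ℕ :=
  Set.ncard {S : Finset ℕ | IsTopOccSet p w S}

def p321 : Fin 3 → ℕ := ![3, 2, 1]
def p3412 : Fin 4 → ℕ := ![3, 4, 1, 2]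
def p4321 : Fin 4 → ℕ := ![4, 3, 2, 1]
def p34512 : Fin 5 → ℕ := ![3, 4, 5, 1, 2]
def p45123 : Fin 5 → ℕ := ![4, 5, 1, 2, 3]
def p35412 : Fin 5 → ℕ := ![3, 5, 4, 1, 2]
def p43512 : Fin 5 → ℕ := ![4, 3, 5, 1, 2]
def p45132 : Fin 5 → ℕ := ![4, 5, 1, 3, 2]
def p45213 : Fin 5 → ℕ := ![4, 5, 2, 1, 3]
def p53412 : Fin 5 → ℕ := ![5, 3, 4, 1, 2]
def p45312 : Fin 5 → ℕ := ![4, 5, 3, 1, 2]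
def p45231 : Fin 5 → ℕ := ![4, 5, 2, 3, 1]

/-- The pattern `𝔭_k(w)` of Definition 4.4, recorded as its set of values:
(I) if `w⁻¹(top)` is left of `w⁻¹(M_k)`, the 321-occurrence `{top, M_k, m_k}`;
(II) else if `wbar(k) > m_k`, the 321-occurrence `{top, wbar(k), m_k}`;
(III) otherwise the 3412-occurrence `{M_k, top, wbar(k), m_k}`. -/
noncomputable def pocc {n : ℕ} (w : Equiv.Perm (Fin (n + 1))) (wbar : Equiv.Perm (Fin n))
    (k : ℕ) : Finset ℕ :=
  if posOf w n < posOf w (Mstat wbar k) then {n, Mstat wbar k, mstat wbar k}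
  else if mstat wbar k < valAt wbar k then {n, valAt wbar k, mstat wbar k}
  else {Mstat wbar k, n, valAt wbar k, mstat wbar k}

/-- A pattern occurs at an increasing sequence of positions as soon as one enumeration `σ` of the
index set sorts both the pattern and the corresponding values. -/
theorem isOccSet_of_sorted {m c : ℕ} {p : Fin c → ℕ} {w : Equiv.Perm (Fin m)} {f : Fin c → Fin m}
    (hf : StrictMono f) (σ : Fin c → Fin c) (hσ : Function.Surjective σ)
    (hp : StrictMono (p ∘ σ)) (hw : StrictMono (fun i => w (f (σ i)))) :
    IsOccSet p w (Finset.image (fun a => (w (f a) : ℕ)) Finset.univ) := by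
  refine ⟨f, hf, fun a b => ?_, rfl⟩
  obtain ⟨a, rfl⟩ := hσ a
  obtain ⟨b, rfl⟩ := hσ b
  exact (hp.lt_iff_lt (a := a) (b := b)).trans (hw.lt_iff_lt (a := a) (b := b)).symm

theorem strictMono_fin_five {α : Type*} [Preorder α] {g : Fin 5 → α}
    (h0 : g 0 < g 1) (h1 : g 1 < g 2) (h2 : g 2 < g 3) (h3 : g 3 < g 4) : StrictMono g := by
  refine Fin.strictMono_iff_lt_succ.2 fun i => ?_
  fin_cases i <;> assumption

theorem exists_isReducedWord {m : ℕ} (w : Equiv.Perm (Fin m)) : ∃ l, IsReducedWord w l := by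
  have hne : {c | ∃ l : List ℕ, IsWord m l w ∧ l.length = c}.Nonempty := by
    suffices h : ∃ l, IsWord m l w from h.elim fun l hl => ⟨_, l, hl, rfl⟩
    cases m with
    | zero => exact ⟨[], by simp, Subsingleton.elim _ _⟩
    | succ m =>
      have hw : w ∈ Submonoid.closure
          (Set.range fun i : Fin m => Equiv.swap i.castSucc i.succ) := by
        rw [Equiv.Perm.mclosure_swap_castSucc_succ]
        trivial
      induction hw using Submonoid.closure_induction with
      | mem x hx =>
        obtain ⟨i, rfl⟩ := hx
        refine ⟨[(i : ℕ)], by simp, ?_⟩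
        simp [sr, Fin.castSucc, Fin.succ, Fin.castAdd, Fin.castLE]
      | one => exact ⟨[], by simp, by simp⟩
      | mul x y _ _ hx hy =>
        obtain ⟨l, hl, rfl⟩ := hx
        obtain ⟨l', hl', rfl⟩ := hy
        refine ⟨l ++ l', fun i hi => ?_, by simp⟩
        exact (List.mem_append.1 hi).elim (hl i) (hl' i)
  exact Nat.sInf_mem hne

theorem sr_apply_le_iff {m i k : ℕ} (h : i ≠ k) (x : Fin m) :
    (sr m i x : ℕ) ≤ k ↔ (x : ℕ) ≤ k := by
  unfold sr
  split_ifs with hi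
  · rw [Equiv.swap_apply_def]
    split_ifs with h1 h2
    · subst h1; simp only; omega
    · subst h2; simp only; omega
    · rfl
  · rfl

theorem prod_sr_apply_le_iff {m k : ℕ} {l : List ℕ} (h : k ∉ l) (x : Fin m) :
    ((l.map (sr m)).prod x : ℕ) ≤ k ↔ (x : ℕ) ≤ k := by
  induction l with
  | nil => simp
  | cons i l ih =>
    rw [List.mem_cons, not_or] at h
    rw [List.map_cons, List.prod_cons, Equiv.Perm.mul_apply, sr_apply_le_iff (Ne.symm h.1), ih h.2]

/-- An inversion across the cut at `k` forces `k` into the support. -/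
theorem mem_supp_of_inversion {m k : ℕ} {w : Equiv.Perm (Fin m)} {x y : Fin m}
    (hx : (x : ℕ) ≤ k) (hy : k < (y : ℕ)) (hxy : w y < w x) : k ∈ supp w := by
  obtain ⟨l, hl⟩ := exists_isReducedWord w
  refine ⟨l, hl, ?_⟩
  by_contra hk
  have h : ∀ z, (w z : ℕ) ≤ k ↔ (z : ℕ) ≤ k := fun z => hl.1.2 ▸ prod_sr_apply_le_iff hk z
  have := h x
  have := h y
  rw [Fin.lt_def] at hxy
  omega

theorem posOf_eq {n : ℕ} {w : Equiv.Perm (Fin (n + 1))} {i : Fin (n + 1)}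
    (h : w i = Fin.last n) : posOf w n = i := by
  have : w⁻¹ ⟨n, n.lt_succ_self⟩ = i := Equiv.Perm.inv_eq_iff_eq.2 h.symm
  simp [posOf, this]

theorem IsDeletion.apply_eq {n : ℕ} {w : Equiv.Perm (Fin (n + 1))} {wbar : Equiv.Perm (Fin n)}
    (hdel : IsDeletion w wbar) {i : Fin (n + 1)} (h : w i = Fin.last n) (j : Fin n) :
    (wbar j : ℕ) = w (i.succAbove j) := by
  rw [hdel j, posOf_eq h]
  have hj := j.isLt
  split_ifs with hji
  · rw [Fin.succAbove_of_castSucc_lt _ _ hji, valAt, dif_pos (by omega)]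
    rfl
  · rw [Fin.succAbove_of_le_castSucc _ _ (Fin.le_def.2 (by simpa using hji)), valAt,
      dif_pos (by omega)]
    rfl

theorem Mstat_eq {m k : ℕ} {w : Equiv.Perm (Fin m)} {x : Fin m} (hx : (x : ℕ) ≤ k)
    (h : ∀ y : Fin m, (y : ℕ) ≤ k → w y ≤ w x) : Mstat w k = w x :=
  IsGreatest.csSup_eq ⟨⟨x, hx, rfl⟩, by rintro _ ⟨y, hy, rfl⟩; exact h y hy⟩

theorem mstat_eq {m k : ℕ} {w : Equiv.Perm (Fin m)} {x : Fin m} (hx : k < (x : ℕ))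
    (h : ∀ y : Fin m, k < (y : ℕ) → w x ≤ w y) : mstat w k = w x :=
  IsLeast.csInf_eq ⟨⟨x, hx, rfl⟩, by rintro _ ⟨y, hy, rfl⟩; exact h y hy⟩

/-- if `w` avoids 45231, 45132, 43512, 34512, and 35412, and some
`N`-occurrence `{a, N, b, c}` of 3412 in `w` has no `k ∈ newrep(w)` with
`(a, b, c) = (M_k, wbar(k), m_k)`, then `w` has an `N`-occurrence of 45123 or 45213. -/
theorem occ3412_is_canonical {n : ℕ} (w : Equiv.Perm (Fin (n + 1)))
    (wbar : Equiv.Perm (Fin n)) (hdel : IsDeletion w wbar)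
    (hav1 : ¬ ∃ S : Finset ℕ, IsOccSet p45231 w S)
    (hav2 : ¬ ∃ S : Finset ℕ, IsOccSet p45132 w S)
    (hav3 : ¬ ∃ S : Finset ℕ, IsOccSet p43512 w S)
    (hav4 : ¬ ∃ S : Finset ℕ, IsOccSet p34512 w S)
    (hav5 : ¬ ∃ S : Finset ℕ, IsOccSet p35412 w S)
    (i1 i2 i3 i4 : Fin (n + 1)) (h12 : i1 < i2) (h23 : i2 < i3) (h34 : i3 < i4)
    (htop : w i2 = Fin.last n)
    (ho1 : w i3 < w i4) (ho2 : w i4 < w i1) (ho3 : w i1 < w i2)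
    (habc : ¬ ∃ k ∈ newrep w wbar, (w i1 : ℕ) = Mstat wbar k ∧
      (w i3 : ℕ) = valAt wbar k ∧ (w i4 : ℕ) = mstat wbar k) :
    (∃ S : Finset ℕ, IsTopOccSet p45123 w S) ∨ (∃ S : Finset ℕ, IsTopOccSet p45213 w S) := by
  by_contra hgoal
  rw [not_or] at hgoal
  have hmax : ∀ x, x ≤ i3 → x ≠ i2 → w x ≤ w i1 := by
    intro x hx3 hx2
    by_contra! hx
    have hxN : w x < w i2 := by
      rw [htop]
      exact Fin.lt_last_iff_ne_last.2 (htop ▸ w.injective.ne hx2)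
    have hx3 : x < i3 := lt_of_le_of_ne hx3 (by rintro rfl; order)
    rcases lt_trichotomy x i1 with h | rfl | h
    · exact hav3 ⟨_, isOccSet_of_sorted (f := ![x, i1, i2, i3, i4])
          (strictMono_fin_five ‹_› ‹_› ‹_› ‹_›) ![3, 4, 1, 0, 2] (by decide) (by decide)
          (strictMono_fin_five ‹_› ‹_› ‹_› ‹_›)⟩
    · order
    rcases lt_or_gt_of_ne hx2 with h | h
    · exact hav4 ⟨_, isOccSet_of_sorted (f := ![i1, x, i2, i3, i4])
          (strictMono_fin_five ‹_› ‹_› ‹_› ‹_›) ![3, 4, 0, 1, 2] (by decide) (by decide)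
          (strictMono_fin_five ‹_› ‹_› ‹_› ‹_›)⟩
    · exact hav5 ⟨_, isOccSet_of_sorted (f := ![i1, i2, x, i3, i4])
          (strictMono_fin_five ‹_› ‹_› ‹_› ‹_›) ![3, 4, 0, 2, 1] (by decide) (by decide)
          (strictMono_fin_five ‹_› ‹_› ‹_› ‹_›)⟩
  have hmin : ∀ x, i3 < x → w i4 ≤ w x := by
    intro x hx3
    by_contra! hx
    rcases lt_trichotomy x i4 with h | rfl | h
    · rcases lt_or_gt_of_ne (w.injective.ne hx3.ne) with h' | h'
      · exact hgoal.1 ⟨_, isOccSet_of_sorted (f := ![i1, i2, i3, x, i4])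
          (strictMono_fin_five ‹_› ‹_› ‹_› ‹_›) ![2, 3, 4, 0, 1] (by decide) (by decide)
          (strictMono_fin_five ‹_› ‹_› ‹_› ‹_›),
          Finset.mem_image.2 ⟨1, Finset.mem_univ _, congrArg Fin.val htop⟩⟩
      · exact hgoal.2 ⟨_, isOccSet_of_sorted (f := ![i1, i2, i3, x, i4])
          (strictMono_fin_five ‹_› ‹_› ‹_› ‹_›) ![3, 2, 4, 0, 1] (by decide) (by decide)
          (strictMono_fin_five ‹_› ‹_› ‹_› ‹_›),
          Finset.mem_image.2 ⟨1, Finset.mem_univ _, congrArg Fin.val htop⟩⟩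
    · order
    · rcases lt_or_gt_of_ne (w.injective.ne hx3.ne) with h' | h'
      · exact hav2 ⟨_, isOccSet_of_sorted (f := ![i1, i2, i3, i4, x])
          (strictMono_fin_five ‹_› ‹_› ‹_› ‹_›) ![2, 4, 3, 0, 1] (by decide) (by decide)
          (strictMono_fin_five ‹_› ‹_› ‹_› ‹_›)⟩
      · exact hav1 ⟨_, isOccSet_of_sorted (f := ![i1, i2, i3, i4, x])
          (strictMono_fin_five ‹_› ‹_› ‹_› ‹_›) ![4, 2, 3, 0, 1] (by decide) (by decide)
          (strictMono_fin_five ‹_› ‹_› ‹_› ‹_›)⟩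
  have hval := hdel.apply_eq htop
  obtain ⟨j1, rfl⟩ := Fin.exists_succAbove_eq h12.ne
  obtain ⟨j3, rfl⟩ := Fin.exists_succAbove_eq h23.ne'
  obtain ⟨j4, rfl⟩ := Fin.exists_succAbove_eq (h23.trans h34).ne'
  have h13 : j1 < j3 := (Fin.strictMono_succAbove i2).lt_iff_lt.1 (h12.trans h23)
  have hj34 : j3 < j4 := (Fin.strictMono_succAbove i2).lt_iff_lt.1 h34
  refine habc ⟨j3, ⟨mem_supp_of_inversion (x := j1) (y := j4) h13.le hj34 ?_, ?_⟩, ?_, ?_, ?_⟩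
  · rwa [Fin.lt_def, hval, hval, ← Fin.lt_def]
  · rw [posOf_eq htop]
    exact Fin.le_def.1 (Fin.lt_succAbove_iff_le_castSucc i2 j3 |>.1 h23)
  · rw [Mstat_eq (x := j1) h13.le fun y hy => ?_, hval]
    rw [Fin.le_def, hval, hval, ← Fin.le_def]
    exact hmax _ ((Fin.strictMono_succAbove i2).le_iff_le.2 hy) (Fin.succAbove_ne i2 y)
  · rw [valAt, dif_pos j3.isLt, hval]
  · rw [mstat_eq (x := j4) hj34 fun y hy => ?_, hval]
    rw [Fin.le_def, hval, hval, ← Fin.le_def]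
    exact hmin _ ((Fin.strictMono_succAbove i2).lt_iff_lt.2 hy)
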